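/- Let D̃ be a diagonal positive-semidefinite matrix on a finite index set, P a row-stochastic matrix, γ ∈ (0,1), α ∈ [0,1], and x a vector satisfying ‖Px‖_{D̃}² ≤ (1 + α(1−γ)/4) ‖x‖_{D̃}². Then x^T D̃ (I − γP) x ≥ (3/4)(1−γ) ‖x‖_{D̃}². -/

import Mathlib

open Matrix BigOperators

/-- if `‖Px‖_{D̃}² ≤ (1 + α(1−γ)/4) ‖x‖_{D̃}²`, then
`xᵀ D̃ (I − γP) x ≥ (3/4)(1−γ) ‖x‖_{D̃}²`. -/
theorem stmt14 {I : Type*} [Fintype I] [DecidableEq I]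
    (P : Matrix I I ℝ) (hPnn : ∀ i j, 0 ≤ P i j) (hProw : ∀ i, ∑ j, P i j = 1)
    (w : I → ℝ) (hw : ∀ i, 0 ≤ w i)
    (γ : ℝ) (hγ0 : 0 < γ) (hγ1 : γ < 1)
    (α : ℝ) (hα0 : 0 ≤ α) (hα1 : α ≤ 1)
    (x : I → ℝ)
    (hx : ∑ i, w i * (P.mulVec x i) ^ 2 ≤ (1 + α * (1 - γ) / 4) * ∑ i, w i * (x i) ^ 2) :
    (3 / 4) * (1 - γ) * ∑ i, w i * (x i) ^ 2
      ≤ x ⬝ᵥ ((Matrix.diagonal w * (1 - γ • P)).mulVec x) := by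
  have hA : 0 ≤ ∑ i, w i * (x i) ^ 2 :=
    Finset.sum_nonneg fun i _ => mul_nonneg (hw i) (sq_nonneg _)
  have hC : 2 * ∑ i, w i * (x i * P.mulVec x i)
      ≤ ∑ i, w i * (x i) ^ 2 + ∑ i, w i * (P.mulVec x i) ^ 2 := by
    rw [Finset.mul_sum, ← Finset.sum_add_distrib]
    refine Finset.sum_le_sum fun i _ => ?_
    nlinarith [mul_nonneg (hw i) (sq_nonneg (x i - P.mulVec x i))]
  have hE : x ⬝ᵥ ((Matrix.diagonal w * (1 - γ • P)).mulVec x)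
      = ∑ i, w i * (x i) ^ 2 - γ * ∑ i, w i * (x i * P.mulVec x i) := by
    rw [← Matrix.mulVec_mulVec, Matrix.sub_mulVec, Matrix.one_mulVec, Matrix.smul_mulVec,
      Finset.mul_sum, ← Finset.sum_sub_distrib]
    simp only [dotProduct, Matrix.mulVec_diagonal, Pi.sub_apply, Pi.smul_apply, smul_eq_mul]
    refine Finset.sum_congr rfl fun i _ => ?_
    ring
  rw [hE]
  generalize ∑ i, w i * (x i) ^ 2 = A at *
  generalize ∑ i, w i * (P.mulVec x i) ^ 2 = B at *
  generalize ∑ i, w i * (x i * P.mulVec x i) = C at *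
  have h1 : γ * (2 * C) ≤ γ * (A + (1 + α * (1 - γ) / 4) * A) :=
    mul_le_mul_of_nonneg_left (by linarith) hγ0.le
  have h2 : γ * α ≤ 1 := by nlinarith
  have h3 : 0 ≤ (1 - γ * α) * ((1 - γ) * A) :=
    mul_nonneg (by linarith) (mul_nonneg (by linarith) hA)
  have h4 : 0 ≤ (1 - γ) * A := mul_nonneg (by linarith) hA
  nlinarith
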